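/- arXiv:1506.06967 — 3 statements merged into one kernel-verified Lean document; each statement's English description precedes it below -/
import Mathlib

section
/- Let I be a semigroup, let (A, α) and (C, γ) be I-sets, let S be an index set and for each s ∈ S let (B_s, β(s)) be a semi-invertible I-set. Let B = ∏_{s∈S} B_s be the product set with the componentwise I-action β, i.e. β_l(i)((b_s)_{s∈S}) = (β(s)_l(i)(b_s))_{s∈S} and β_r(i)((b_s)_{s∈S}) = (β(s)_r(i)(b_s))_{s∈S}. If f : A → B and g : B → C are I-equivariant functions, then the composition g ∘ f : A → C is I-equivariant. -/
/-- An action of a semigroup `I` on a set `A`: a commuting pair of a left action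
and a right action. -/
structure BiAction (I : Type*) [Semigroup I] (A : Type*) where
  l : I → A → A
  r : I → A → A
  l_mul : ∀ i j a, l (i * j) a = l i (l j a)
  r_mul : ∀ i j a, r (i * j) a = r j (r i a)
  comm : ∀ i j a, r j (l i a) = l i (r j a)

/-- `f : A → B` is `I`-equivariant. -/
def IsEquivariant {I A B : Type*} [Semigroup I] (α : BiAction I A) (β : BiAction I B)
    (f : A → B) : Prop :=
  ∀ i a, β.r i (f (α.l i a)) = β.l i (f (α.r i a))

/-- An `I`-set is semi-invertible if for every `i` at least one of the two
components of the action is a bijection. -/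
def SemiInvertible {I A : Type*} [Semigroup I] (α : BiAction I A) : Prop :=
  ∀ i, Function.Bijective (α.l i) ∨ Function.Bijective (α.r i)

/-- The componentwise action on a product of `I`-sets. -/
def prodAction {I : Type*} [Semigroup I] {S : Type*} {B : S → Type*}
    (β : ∀ s, BiAction I (B s)) : BiAction I (∀ s, B s) where
  l i b := fun s => (β s).l i (b s)
  r i b := fun s => (β s).r i (b s)
  l_mul := by intro i j b; funext s; exact (β s).l_mul i j (b s)
  r_mul := by intro i j b; funext s; exact (β s).r_mul i j (b s)
  comm := by intro i j b; funext s; exact (β s).comm i j (b s)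

/-- In a semi-invertible `I`-set, two elements `x`, `y` with `r i x = l i y` have a common
source `b`, with `x = l i b` and `y = r i b`. -/
theorem SemiInvertible.exists_common_source {I A : Type*} [Semigroup I] {α : BiAction I A}
    (hα : SemiInvertible α) {i : I} {x y : A} (h : α.r i x = α.l i y) :
    ∃ b, α.l i b = x ∧ α.r i b = y := by
  rcases hα i with hl | hr
  · obtain ⟨b, rfl⟩ := hl.surjective x
    exact ⟨b, rfl, hl.injective (by rw [← α.comm, h])⟩
  · obtain ⟨b, rfl⟩ := hr.surjective y
    exact ⟨b, hr.injective (by rw [α.comm, h]), rfl⟩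

/-- if each `(B_s, β(s))` is a semi-invertible `I`-set, `f : A → ∏ B_s`
and `g : ∏ B_s → C` are `I`-equivariant, then `g ∘ f` is `I`-equivariant. -/
theorem comp_equivariant_through_semiInvertible_product
    {I : Type*} [Semigroup I] {A C : Type*} {S : Type*} {B : S → Type*}
    (α : BiAction I A) (γ : BiAction I C) (β : ∀ s, BiAction I (B s))
    (hβ : ∀ s, SemiInvertible (β s))
    (f : A → ∀ s, B s) (g : (∀ s, B s) → C)
    (hf : IsEquivariant α (prodAction β) f)
    (hg : IsEquivariant (prodAction β) γ g) :
    IsEquivariant α γ (g ∘ f) := by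
  intro i a
  choose b hl hr using fun s => (hβ s).exists_common_source (congrFun (hf i a) s)
  have hl' : (prodAction β).l i b = f (α.l i a) := funext hl
  have hr' : (prodAction β).r i b = f (α.r i a) := funext hr
  simpa only [Function.comp_apply, hl', hr'] using hg i b
end

section
/- Let I be a semigroup and let (A, α) and (B, β) be semi-invertible I-sets with A and B finite. If f : A → B is a bijective I-equivariant function, then the inverse function f⁻¹ : B → A is I-equivariant. -/
/-- If `L` commutes with `R`, `L'` commutes with `R'` and `R' ∘ f ∘ L = L' ∘ f ∘ R`, where `L` is
surjective and one of `L'`, `R'` is bijective, then `R ∘ g ∘ L' = L ∘ g ∘ R'` for `g` the inverse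
of `f`. -/
theorem inverse_intertwines_of_surjective {A B : Type*} [Finite B]
    {L R : A → A} {L' R' : B → B} {f : A → B} {g : B → A}
    (hc : ∀ a, R (L a) = L (R a)) (hc' : ∀ b, R' (L' b) = L' (R' b))
    (hL : Function.Surjective L) (hβ : Function.Bijective L' ∨ Function.Bijective R')
    (hf : ∀ a, R' (f (L a)) = L' (f (R a)))
    (hgl : Function.LeftInverse g f) (hgr : Function.RightInverse g f) (b : B) :
    R (g (L' b)) = L (g (R' b)) := by
  have hinj : Function.Injective L' := by
    rcases hβ with h | h
    · exact h.injective
    · refine Finite.injective_iff_surjective.mpr fun c => ?_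
      obtain ⟨a, ha⟩ := (h.surjective.comp (hgr.surjective.comp hL)) c
      exact ⟨f (R a), (hf a).symm.trans ha⟩
  obtain ⟨z, hz⟩ := hL (g (L' b))
  have hRz : f (R z) = R' b := hinj (by rw [← hf, hz, hgr, hc'])
  rw [← hz, hc, ← hRz, hgl]

/-- a bijective equivariant function between finite semi-invertible
`I`-sets has an equivariant inverse. -/
theorem inverse_of_bijective_equivariant_isEquivariant
    {I A B : Type*} [Semigroup I] [Finite A] [Finite B]
    (α : BiAction I A) (β : BiAction I B)
    (hα : SemiInvertible α) (hβ : SemiInvertible β)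
    (f : A → B) (hf : IsEquivariant α β f) (hbij : Function.Bijective f)
    (g : B → A) (hgl : Function.LeftInverse g f) (hgr : Function.RightInverse g f) :
    IsEquivariant β α g := by
  intro i b
  rcases hα i with h | h
  · exact inverse_intertwines_of_surjective (α.comm i i) (β.comm i i) h.surjective (hβ i)
      (hf i) hgl hgr b
  · exact (inverse_intertwines_of_surjective (fun a => (α.comm i i a).symm)
      (fun b => (β.comm i i b).symm) h.surjective (hβ i).symm
      (fun a => (hf i a).symm) hgl hgr b).symm
end

section
/- Let I be a semigroup and let (A, α), (B, β), (C, γ), (D, δ) be I-sets. If f : A → B and h : C → D are I-equivariant functions, then the induced function from [B, C] to [A, D] sending g to h ∘ g ∘ f is I-equivariant with respect to the induced actions [β, γ] on [B, C] and [α, δ] on [A, D]. -/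
/-- The induced `I`-action `[α, β]` on the set `[A, B]` of all functions `A → B`:
`[α,β]_l(i)(f) = β_l(i) ∘ f ∘ α_r(i)` and `[α,β]_r(i)(f) = β_r(i) ∘ f ∘ α_l(i)`. -/
def funAction {I A B : Type*} [Semigroup I] (α : BiAction I A) (β : BiAction I B) :
    BiAction I (A → B) where
  l i f := fun a => β.l i (f (α.r i a))
  r i f := fun a => β.r i (f (α.l i a))
  l_mul := by intro i j f; funext a; simp only [α.r_mul, β.l_mul]
  r_mul := by intro i j f; funext a; simp only [α.l_mul, β.r_mul]
  comm := by intro i j f; funext a; simp only [β.comm, α.comm]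

/-- if `f : A → B` and `h : C → D` are `I`-equivariant, then
`g ↦ h ∘ g ∘ f` is `I`-equivariant from `[B, C]` to `[A, D]`. -/
theorem induced_map_on_function_sets_isEquivariant
    {I A B C D : Type*} [Semigroup I]
    (α : BiAction I A) (β : BiAction I B) (γ : BiAction I C) (δ : BiAction I D)
    (f : A → B) (h : C → D)
    (hf : IsEquivariant α β f) (hh : IsEquivariant γ δ h) :
    IsEquivariant (funAction β γ) (funAction α δ) (fun g => h ∘ g ∘ f) := by
  intro i g
  funext a
  change δ.r i (h (γ.l i (g (β.r i (f (α.l i a)))))) = δ.l i (h (γ.r i (g (β.l i (f (α.r i a))))))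
  rw [hh, hf]
end
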